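/- Let $d\ge 2$ and $k\ge 1$ be integers, let $X\in\mathbb{R}^d$ and $\sigma>0$. Let $c_1,\dots,c_k$ be i.i.d. random vectors uniformly distributed on the unit sphere $\mathbb{S}^{d-1}=\{x\in\mathbb{R}^d:\|x\|=1\}$, let $Z\sim\mathcal{N}(0,I_d)$ be independent of $(c_1,\dots,c_k)$, and put $\rho=X+\sum_{i=1}^k c_i+\sigma Z$. Then $\frac1k\sum_{i=1}^k\langle c_i,\rho\rangle$ is square-integrable, $$\mathbb{E}\Bigl[\frac1k\sum_{i=1}^k\langle c_i,\rho\rangle\Bigr]=1\qquad\text{and}\qquad \operatorname{Var}\Bigl[\frac1k\sum_{i=1}^k\langle c_i,\rho\rangle\Bigr]=\frac1k\Bigl(\frac{\|X\|^2}{d}+\frac{2(k-1)}{d}+\sigma^2\Bigr).$$ -/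

import Mathlib

open MeasureTheory ProbabilityTheory
open scoped InnerProductSpace

/-- The uniform distribution on the unit sphere `S^{d-1}` of `ℝ^d`, as a measure on `ℝ^d`
carried by the sphere: the surface measure of the sphere (the one induced by Lebesgue measure),
normalized to total mass `1`. -/
noncomputable def uniformSphere (d : ℕ) : Measure (EuclideanSpace ℝ (Fin d)) :=
  (((volume : Measure (EuclideanSpace ℝ (Fin d))).toSphere Set.univ)⁻¹ •
    (volume : Measure (EuclideanSpace ℝ (Fin d))).toSphere).map Subtype.val

/-- One-shot random-canary setup on a probability space `(Ω, P)`: the canaries `c_1, …, c_k` are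
i.i.d. uniform on the unit sphere of `ℝ^d`, and `Z ∼ N(0, I_d)` is independent of
`(c_1, …, c_k)`. -/
structure IsCanarySetup {Ω : Type*} [MeasurableSpace Ω] (P : Measure Ω) {d k : ℕ}
    (c : Fin k → Ω → EuclideanSpace ℝ (Fin d)) (Z : Ω → EuclideanSpace ℝ (Fin d)) : Prop where
  law_canary : ∀ i, HasLaw (c i) (uniformSphere d) P
  law_noise : HasLaw Z (stdGaussian (EuclideanSpace ℝ (Fin d))) P
  indep_canaries : iIndepFun c P
  indep_noise : IndepFun (fun ω i => c i ω) Z P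

/-- The mechanism output `ρ = X + ∑_{i=1}^k c_i + σ Z`. -/
noncomputable def canaryOutput {Ω : Type*} {d k : ℕ} (X : EuclideanSpace ℝ (Fin d)) (σ : ℝ)
    (c : Fin k → Ω → EuclideanSpace ℝ (Fin d)) (Z : Ω → EuclideanSpace ℝ (Fin d)) (ω : Ω) :
    EuclideanSpace ℝ (Fin d) :=
  X + ∑ i, c i ω + σ • Z ω

lemma ProbabilityTheory.IndepFun.integral_comp_prod {Ω E F : Type*} [MeasurableSpace Ω]
    [MeasurableSpace E] [MeasurableSpace F] {P : Measure Ω} [IsProbabilityMeasure P]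
    {μ : Measure E} [SigmaFinite μ] {U : Ω → F} {V : Ω → E} (hUV : IndepFun U V P)
    (hU : AEMeasurable U P) (hV : HasLaw V μ P) {φ : F × E → ℝ} (hφ : Measurable φ)
    (hint : Integrable (fun ω => φ (U ω, V ω)) P) :
    ∫ ω, φ (U ω, V ω) ∂P = ∫ ω, ∫ v, φ (U ω, v) ∂μ ∂P := by
  have hmap := hUV.map_prod_eq_prod_map_map hU hV.aemeasurable
  rw [hV.map_eq] at hmap
  have hUV' : AEMeasurable (fun ω => (U ω, V ω)) P := hU.prodMk hV.aemeasurable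
  have := Measure.isProbabilityMeasure_map hU
  rw [← integral_map hUV' hφ.aestronglyMeasurable, hmap, integral_prod,
    integral_map hU]
  · exact hφ.stronglyMeasurable.integral_prod_right'.aestronglyMeasurable
  · rw [← hmap]
    exact (integrable_map_measure hφ.aestronglyMeasurable hUV').2 hint

section Isotropic

variable {E : Type*} [NormedAddCommGroup E] [InnerProductSpace ℝ E] [MeasurableSpace E]

/-- A square-integrable measure `μ` is centered and isotropic with variance `α` if every linear
functional `⟪·, x⟫` has mean `0` and second moment `α * ‖x‖ ^ 2` under `μ`. -/
structure IsCenteredIsotropic (μ : Measure E) (α : ℝ) : Prop where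
  memLp_id : MemLp id 2 μ
  integral_inner : ∀ x : E, ∫ v, ⟪v, x⟫_ℝ ∂μ = 0
  integral_inner_sq : ∀ x : E, ∫ v, ⟪v, x⟫_ℝ ^ 2 ∂μ = α * ‖x‖ ^ 2

variable {Ω F : Type*} [MeasurableSpace Ω] [MeasurableSpace F] {P : Measure Ω}
  {μ : Measure E} {α : ℝ} {U : Ω → F} {V : Ω → E} {f : F → ℝ} {g : F → E}

lemma IsCenteredIsotropic.memLp_of_hasLaw (hμ : IsCenteredIsotropic μ α) (hV : HasLaw V μ P) :
    MemLp V 2 P := by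
  have h := hμ.memLp_id
  rw [← hV.map_eq] at h
  exact h.comp_of_map hV.aemeasurable

variable [BorelSpace E]

lemma ProbabilityTheory.IndepFun.memLp_inner [IsFiniteMeasure P] (hUV : IndepFun U V P) (hg : Measurable g)
    (hV : MemLp V 2 P) (hgU : MemLp (fun ω => g (U ω)) 2 P) :
    MemLp (fun ω => ⟪V ω, g (U ω)⟫_ℝ) 2 P := by
  have hmeas : AEStronglyMeasurable (fun ω => ⟪V ω, g (U ω)⟫_ℝ) P := hV.1.inner hgU.1
  rw [memLp_two_iff_integrable_sq hmeas]
  have hind : IndepFun (fun ω => ‖V ω‖ ^ 2) (fun ω => ‖g (U ω)‖ ^ 2) P :=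
    hUV.symm.comp (φ := fun v => ‖v‖ ^ 2) (ψ := fun u => ‖g u‖ ^ 2) (by fun_prop) (by fun_prop)
  have hint := hind.integrable_mul hV.integrable_norm_pow' hgU.integrable_norm_pow'
  refine hint.mono' (hmeas.pow 2) (Filter.Eventually.of_forall fun ω => ?_)
  have := abs_real_inner_le_norm (V ω) (g (U ω))
  simp only [norm_pow, Real.norm_eq_abs, Pi.mul_apply, ← mul_pow]
  gcongr

/-- Adding to `f U` the inner product of `g U` with an independent centered isotropic vector `V`
keeps the mean and adds `α * 𝔼 ‖g U‖ ^ 2` to the second moment. -/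
lemma IsCenteredIsotropic.moments_add_inner [SecondCountableTopology E]
    [IsProbabilityMeasure P] [SigmaFinite μ] (hμ : IsCenteredIsotropic μ α)
    (hV : HasLaw V μ P) (hUV : IndepFun U V P) (hU : AEMeasurable U P) (hf : Measurable f)
    (hg : Measurable g) (hfU : MemLp (fun ω => f (U ω)) 2 P)
    (hgU : MemLp (fun ω => g (U ω)) 2 P) :
    MemLp (fun ω => f (U ω) + ⟪V ω, g (U ω)⟫_ℝ) 2 P ∧
    ∫ ω, (f (U ω) + ⟪V ω, g (U ω)⟫_ℝ) ∂P = ∫ ω, f (U ω) ∂P ∧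
    ∫ ω, (f (U ω) + ⟪V ω, g (U ω)⟫_ℝ) ^ 2 ∂P =
      ∫ ω, f (U ω) ^ 2 ∂P + α * ∫ ω, ‖g (U ω)‖ ^ 2 ∂P := by
  have hI := hUV.memLp_inner hg (hμ.memLp_of_hasLaw hV) hgU
  have hI1 := hI.integrable one_le_two
  have hIf := hfU.integrable_mul hI
  have h1 : ∫ ω, ⟪V ω, g (U ω)⟫_ℝ ∂P = 0 := by
    rw [hUV.integral_comp_prod hU hV (φ := fun p => ⟪p.2, g p.1⟫_ℝ) (by fun_prop) hI1]
    simp [hμ.integral_inner]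
  have h2 : ∫ ω, f (U ω) * ⟪V ω, g (U ω)⟫_ℝ ∂P = 0 := by
    rw [hUV.integral_comp_prod hU hV (φ := fun p => f p.1 * ⟪p.2, g p.1⟫_ℝ) (by fun_prop) hIf]
    simp [integral_const_mul, hμ.integral_inner]
  have h3 : ∫ ω, ⟪V ω, g (U ω)⟫_ℝ ^ 2 ∂P = α * ∫ ω, ‖g (U ω)‖ ^ 2 ∂P := by
    rw [hUV.integral_comp_prod hU hV (φ := fun p => ⟪p.2, g p.1⟫_ℝ ^ 2) (by fun_prop)
      hI.integrable_sq]
    simp [integral_const_mul, hμ.integral_inner_sq]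
  refine ⟨hfU.add hI, ?_, ?_⟩
  · rw [integral_add (hfU.integrable one_le_two) hI1, h1, add_zero]
  · have hexp : ∀ ω, (f (U ω) + ⟪V ω, g (U ω)⟫_ℝ) ^ 2 =
        f (U ω) ^ 2 + 2 * (f (U ω) * ⟪V ω, g (U ω)⟫_ℝ) + ⟪V ω, g (U ω)⟫_ℝ ^ 2 :=
      fun ω => by ring
    have hIf2 : Integrable (fun ω => 2 * (f (U ω) * ⟪V ω, g (U ω)⟫_ℝ)) P := hIf.const_mul 2
    simp_rw [hexp]
    have hsum : Integrable (fun ω => f (U ω) ^ 2 + 2 * (f (U ω) * ⟪V ω, g (U ω)⟫_ℝ)) P :=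
      hfU.integrable_sq.add hIf2
    rw [integral_add hsum hI.integrable_sq,
      integral_add hfU.integrable_sq hIf2, integral_const_mul, h2, h3, mul_zero, add_zero]

lemma isCenteredIsotropic_stdGaussian [FiniteDimensional ℝ E] :
    IsCenteredIsotropic (stdGaussian E) 1 where
  memLp_id := IsGaussian.memLp_two_id
  integral_inner x := by
    have := integral_strongDual_stdGaussian (innerSL ℝ x)
    simpa [real_inner_comm] using this
  integral_inner_sq x := by
    have h0 := integral_strongDual_stdGaussian (innerSL ℝ x)
    have h := variance_dual_stdGaussian (innerSL ℝ x)
    rw [variance_of_integral_eq_zero (by fun_prop) h0] at h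
    simpa [real_inner_comm] using h

end Isotropic

section UniformSphere

variable {d : ℕ}

lemma ae_norm_eq_one_uniformSphere : ∀ᵐ v ∂(uniformSphere d), ‖v‖ = 1 := by
  rw [uniformSphere, ae_map_iff (by fun_prop) (measurableSet_eq_fun (by fun_prop) (by fun_prop))]
  exact Filter.Eventually.of_forall fun v => by simp

lemma isProbabilityMeasure_uniformSphere (hd : d ≠ 0) :
    IsProbabilityMeasure (uniformSphere d) := by
  have : NeZero d := ⟨hd⟩
  have : Nonempty (Fin d) := ⟨0⟩
  constructor
  rw [uniformSphere, Measure.map_apply (by fun_prop) .univ, Set.preimage_univ,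
    Measure.smul_apply, smul_eq_mul]
  exact ENNReal.inv_mul_cancel
    (Measure.measure_univ_ne_zero.2 (Measure.toSphere_ne_zero volume)) (measure_ne_top _ _)

lemma map_linearIsometryEquiv_uniformSphere
    (e : EuclideanSpace ℝ (Fin d) ≃ₗᵢ[ℝ] EuclideanSpace ℝ (Fin d)) :
    (uniformSphere d).map e = uniformSphere d := by
  ext s hs
  have he : Measurable e := e.continuous.measurable
  have hv : Measurable (Subtype.val : Metric.sphere (0 : EuclideanSpace ℝ (Fin d)) 1 → _) :=
    measurable_subtype_coe
  rw [Measure.map_apply he hs, uniformSphere, Measure.map_apply hv (he hs),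
    Measure.map_apply hv hs, Measure.smul_apply, Measure.smul_apply,
    Measure.toSphere_apply' _ (hv (he hs)), Measure.toSphere_apply' _ (hv hs)]
  congr 2
  rw [← e.symm.measurePreserving.measure_preimage_equiv (f := e.symm.toMeasurableEquiv)]
  congr 1
  ext v
  simp only [Set.mem_smul, Set.mem_preimage, Set.mem_image]
  constructor
  · rintro ⟨r, hr, _, ⟨w, hw, rfl⟩, h⟩
    refine ⟨r, hr, e w, ⟨⟨e w, by simp⟩, hw, rfl⟩, ?_⟩
    apply e.symm.injective
    simpa using h
  · rintro ⟨r, hr, _, ⟨w, hw, rfl⟩, rfl⟩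
    exact ⟨r, hr, e.symm w, ⟨⟨e.symm w, by simp⟩, by simpa using hw, rfl⟩, by simp⟩

lemma integral_comp_linearIsometryEquiv_uniformSphere
    (e : EuclideanSpace ℝ (Fin d) ≃ₗᵢ[ℝ] EuclideanSpace ℝ (Fin d))
    (φ : EuclideanSpace ℝ (Fin d) → ℝ) :
    ∫ v, φ (e v) ∂(uniformSphere d) = ∫ v, φ v ∂(uniformSphere d) := by
  conv_rhs => rw [← map_linearIsometryEquiv_uniformSphere e]
  exact (e.toHomeomorph.measurableEmbedding.integral_map φ).symm

lemma integral_inner_sq_uniformSphere_eq {x y : EuclideanSpace ℝ (Fin d)} (h : ‖x‖ = ‖y‖) :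
    ∫ v, ⟪v, x⟫_ℝ ^ 2 ∂(uniformSphere d) = ∫ v, ⟪v, y⟫_ℝ ^ 2 ∂(uniformSphere d) := by
  set e := (ℝ ∙ (x - y))ᗮ.reflection with he
  have hxy : e x = y := Submodule.reflection_sub h
  rw [← integral_comp_linearIsometryEquiv_uniformSphere e (fun v => ⟪v, y⟫_ℝ ^ 2)]
  simp_rw [← hxy, e.inner_map_map]

lemma isCenteredIsotropic_uniformSphere (hd : d ≠ 0) :
    IsCenteredIsotropic (uniformSphere d) (1 / (d : ℝ)) := by
  have := isProbabilityMeasure_uniformSphere hd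
  have hL : MemLp id 2 (uniformSphere d) :=
    MemLp.of_bound (by fun_prop) 1 (ae_norm_eq_one_uniformSphere.mono fun v hv => hv.le)
  refine ⟨hL, fun x => ?_, fun x => ?_⟩
  · have h := integral_comp_linearIsometryEquiv_uniformSphere (LinearIsometryEquiv.neg ℝ)
      (fun v : EuclideanSpace ℝ (Fin d) => ⟪v, x⟫_ℝ)
    simp only [LinearIsometryEquiv.coe_neg, inner_neg_left, integral_neg] at h
    linarith
  · have hcoord : ∀ i : Fin d, ∫ v, ⟪v, x⟫_ℝ ^ 2 ∂(uniformSphere d) =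
        ‖x‖ ^ 2 * ∫ v, v i ^ 2 ∂(uniformSphere d) := fun i => by
      rw [integral_inner_sq_uniformSphere_eq (y := ‖x‖ • EuclideanSpace.single i (1 : ℝ))
        (by simp [norm_smul]), ← integral_const_mul]
      simp [inner_smul_right, EuclideanSpace.inner_single_right, mul_pow]
    have hsum : ∑ i : Fin d, ∫ v, v i ^ 2 ∂(uniformSphere d) = 1 := by
      rw [← integral_finsetSum]
      · rw [integral_congr_ae (g := fun _ => (1 : ℝ))]
        · simp
        · filter_upwards [ae_norm_eq_one_uniformSphere] with v hv
          rw [← EuclideanSpace.real_norm_sq_eq, hv, one_pow]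
      · intro i _
        refine Integrable.of_bound (by fun_prop) 1 ?_
        filter_upwards [ae_norm_eq_one_uniformSphere] with v hv
        have := PiLp.norm_apply_le v i
        rw [hv] at this
        rw [norm_pow]
        exact pow_le_one₀ (norm_nonneg _) this
    have h : ∑ _i : Fin d, ∫ v, ⟪v, x⟫_ℝ ^ 2 ∂(uniformSphere d) = ‖x‖ ^ 2 := by
      rw [Finset.sum_congr rfl fun i _ => hcoord i, ← Finset.mul_sum, hsum, mul_one]
    rw [Finset.sum_const, Finset.card_univ, Fintype.card_fin, nsmul_eq_mul] at h
    have hd' : (d : ℝ) ≠ 0 := by exact_mod_cast hd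
    field_simp
    linarith

end UniformSphere

section Sum

variable {Ω ι E : Type*} [MeasurableSpace Ω] {P : Measure Ω} [IsProbabilityMeasure P]
  [NormedAddCommGroup E] [InnerProductSpace ℝ E] [MeasurableSpace E] [BorelSpace E]
  [SecondCountableTopology E] {μ : Measure E} [SigmaFinite μ] {α : ℝ} {c : ι → Ω → E}

/-- First two moments of `⟪S, x⟫ + ‖S‖ ^ 2 - n` for a sum `S` of `n` independent centered isotropic
unit vectors. -/
lemma IsCenteredIsotropic.moments_sum (hμ : IsCenteredIsotropic μ α)
    (hnorm : ∀ᵐ v ∂μ, ‖v‖ = 1) (hc : ∀ i, HasLaw (c i) μ P) (hind : iIndepFun c P) (x : E)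
    (s : Finset ι) :
    MemLp (fun ω => ⟪∑ i ∈ s, c i ω, x⟫_ℝ + ‖∑ i ∈ s, c i ω‖ ^ 2 - s.card) 2 P ∧
    ∫ ω, (⟪∑ i ∈ s, c i ω, x⟫_ℝ + ‖∑ i ∈ s, c i ω‖ ^ 2 - s.card) ∂P = 0 ∧
    ∫ ω, (⟪∑ i ∈ s, c i ω, x⟫_ℝ + ‖∑ i ∈ s, c i ω‖ ^ 2 - s.card) ^ 2 ∂P =
      α * (s.card * ‖x‖ ^ 2 + 2 * s.card * (s.card - 1)) := by
  classical
  induction s using Finset.induction_on with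
  | empty => simp
  | insert i s hi ih =>
    obtain ⟨ihL, ih1, ih2⟩ := ih
    set S : Ω → E := fun ω => ∑ j ∈ s, c j ω with hS
    have hSL : MemLp S 2 P := memLp_finsetSum _ fun j _ => hμ.memLp_of_hasLaw (hc j)
    have hindep : IndepFun S (c i) P := by
      have := hind.indepFun_finsetSum_of_notMem₀ (fun j => (hc j).aemeasurable) hi
      convert this using 1
      ext ω
      simp [hS]
    obtain ⟨hL, h1, h2⟩ := hμ.moments_add_inner (hc i) hindep hSL.1.aemeasurable
      (f := fun u => ⟪u, x⟫_ℝ + ‖u‖ ^ 2 - s.card) (g := fun u => x + (2 : ℝ) • u)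
      (by fun_prop) (by fun_prop) ihL ((memLp_const x).add (hSL.const_smul (2 : ℝ)))
    have hunit : ∀ᵐ ω ∂P, ‖c i ω‖ = 1 := by
      have := hnorm
      rw [← (hc i).map_eq] at this
      exact ae_of_ae_map (hc i).aemeasurable this
    have hstep : (fun ω => ⟪∑ j ∈ insert i s, c j ω, x⟫_ℝ + ‖∑ j ∈ insert i s, c j ω‖ ^ 2
        - (insert i s).card) =ᵐ[P]
        fun ω => ⟪S ω, x⟫_ℝ + ‖S ω‖ ^ 2 - s.card + ⟪c i ω, x + (2 : ℝ) • S ω⟫_ℝ := by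
      filter_upwards [hunit] with ω hω
      rw [Finset.sum_insert hi, Finset.card_insert_of_notMem hi, norm_add_sq_real, hω,
        inner_add_left, inner_add_right, inner_smul_right]
      push_cast
      ring
    have hg : ∫ ω, ‖x + (2 : ℝ) • S ω‖ ^ 2 ∂P = ‖x‖ ^ 2 + 4 * s.card := by
      have hexp : ∀ ω, ‖x + (2 : ℝ) • S ω‖ ^ 2 =
          4 * (⟪S ω, x⟫_ℝ + ‖S ω‖ ^ 2 - s.card) + (‖x‖ ^ 2 + 4 * s.card) := fun ω => by
        rw [norm_add_sq_real, inner_smul_right, norm_smul, real_inner_comm, Real.norm_eq_abs,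
          abs_two]
        ring
      simp_rw [hexp]
      rw [integral_add ((ihL.integrable one_le_two).const_mul 4) (integrable_const _),
        integral_const_mul, ih1]
      simp
    refine ⟨hL.ae_eq hstep.symm, ?_, ?_⟩
    · rw [integral_congr_ae hstep, h1, ih1]
    · rw [integral_congr_ae (hstep.mono fun ω hω => congrArg (· ^ 2) hω), h2, ih2, hg,
        Finset.card_insert_of_notMem hi]
      push_cast
      ring

end Sum

theorem mean_var_avg_canary_inner {Ω : Type*} [MeasurableSpace Ω] (P : Measure Ω)
    [IsProbabilityMeasure P] (d k : ℕ) (hd : 2 ≤ d) (hk : 1 ≤ k)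
    (X : EuclideanSpace ℝ (Fin d)) (σ : ℝ) (hσ : 0 < σ)
    (c : Fin k → Ω → EuclideanSpace ℝ (Fin d)) (Z : Ω → EuclideanSpace ℝ (Fin d))
    (h : IsCanarySetup P c Z) :
    MemLp (fun ω => (1 / (k : ℝ)) * ∑ i, ⟪c i ω, canaryOutput X σ c Z ω⟫_ℝ) 2 P ∧
    ∫ ω, (1 / (k : ℝ)) * ∑ i, ⟪c i ω, canaryOutput X σ c Z ω⟫_ℝ ∂P = 1 ∧
    variance (fun ω => (1 / (k : ℝ)) * ∑ i, ⟪c i ω, canaryOutput X σ c Z ω⟫_ℝ) P =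
      (1 / (k : ℝ)) * (‖X‖ ^ 2 / (d : ℝ) + 2 * ((k : ℝ) - 1) / (d : ℝ) + σ ^ 2) := by
  have hd0 : d ≠ 0 := by omega
  have hkR : (k : ℝ) ≠ 0 := by exact_mod_cast (by omega : k ≠ 0)
  have hdR : (d : ℝ) ≠ 0 := by exact_mod_cast hd0
  have := isProbabilityMeasure_uniformSphere hd0
  have hμ := isCenteredIsotropic_uniformSphere hd0
  set S : Ω → EuclideanSpace ℝ (Fin d) := fun ω => ∑ i, c i ω with hS
  have hSL : MemLp S 2 P := memLp_finsetSum _ fun j _ => hμ.memLp_of_hasLaw (h.law_canary j)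
  have hindep : IndepFun S Z P :=
    h.indep_noise.comp (φ := fun v : Fin k → EuclideanSpace ℝ (Fin d) => ∑ i, v i)
      (ψ := id) (by fun_prop) measurable_id
  have hmom (x : EuclideanSpace ℝ (Fin d)) :=
    hμ.moments_sum ae_norm_eq_one_uniformSphere h.law_canary h.indep_canaries x Finset.univ
  simp only [Finset.card_univ, Fintype.card_fin] at hmom
  obtain ⟨hQL, hQ1, hQ2⟩ := hmom X
  have hS2 : ∫ ω, ‖S ω‖ ^ 2 ∂P = k := by
    have h0 := (hmom 0).2.1
    simp only [inner_zero_right, zero_add] at h0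
    rw [integral_sub hSL.integrable_norm_pow' (integrable_const _)] at h0
    simp only [integral_const, probReal_univ, one_smul] at h0
    linarith
  obtain ⟨hL, h1, h2⟩ := isCenteredIsotropic_stdGaussian.moments_add_inner h.law_noise hindep
    hSL.1.aemeasurable (f := fun u => ⟪u, X⟫_ℝ + ‖u‖ ^ 2 - k) (g := fun u => σ • u)
    (by fun_prop) (by fun_prop) hQL (hSL.const_smul σ)
  simp only [norm_smul, mul_pow, Real.norm_eq_abs, sq_abs, integral_const_mul, hS2] at h2
  rw [hQ2] at h2
  rw [hQ1] at h1
  set W : Ω → ℝ := fun ω => ⟪S ω, X⟫_ℝ + ‖S ω‖ ^ 2 - k + ⟪Z ω, σ • S ω⟫_ℝ with hW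
  have hT : (fun ω => (1 / (k : ℝ)) * ∑ i, ⟪c i ω, canaryOutput X σ c Z ω⟫_ℝ) =
      fun ω => 1 / (k : ℝ) * W ω + 1 := by
    ext ω
    rw [← sum_inner, canaryOutput]
    change 1 / (k : ℝ) * ⟪S ω, X + S ω + σ • Z ω⟫_ℝ = _
    simp only [hW, inner_add_right, inner_smul_right, real_inner_self_eq_norm_sq,
      real_inner_comm (Z ω) (S ω)]
    field_simp
    ring
  have hWk : MemLp (fun ω => 1 / (k : ℝ) * W ω) 2 P := hL.const_mul _
  rw [hT]
  refine ⟨hWk.add (memLp_const 1), ?_, ?_⟩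
  · rw [integral_add (hWk.integrable one_le_two) (integrable_const _), integral_const_mul, h1]
    simp
  · rw [variance_add_const hWk.1, variance_const_mul,
      variance_of_integral_eq_zero hL.1.aemeasurable h1]
    rw [h2]
    field_simp
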